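/- There exist no positive integer n and no finite collection of isotone ω₁-indexed sequences (x_{i,ξ})_{ξ<ω₁} of elements of F(ω₁), for 0 ≤ i ≤ n, such that: (1) x_{0,ξ} = 0 and x_{n,ξ} = c_ξ for all large enough ξ < ω₁; (2) x_{i,ξ} ≤ c_ξ for all i ≤ n and all large enough ξ < ω₁; and (3) for all i < n and all ξ < ω₁, either x_{i+1,ξ} ≤ a ∨ x_{i,ξ} or x_{i+1,ξ} ≤ b ∨ x_{i,ξ}. -/

import Mathlib

section Tower

variable {D : Type*} [SemilatticeSup D] [OrderBot D]

/-- `x` is a reduced finite subset of `C(A)`, for a subset `A` of the ambient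
`∨,0`-semilattice `D`. -/
def IsReducedIn (A : Set D) (x : Set (D × D × D)) : Prop :=
  x.Finite ∧
  (∀ t ∈ x, t.1 ∈ A ∧ t.2.1 ∈ A ∧ t.2.2 ∈ A ∧ t.2.2 ≤ t.1 ⊔ t.2.1) ∧
  (∃! u : D, (u, u, u) ∈ x) ∧
  (∀ u v w : D, (u, v, w) ∈ x → (v, u, w) ∈ x → u = v ∧ v = w) ∧
  (∀ p u v w : D, (p, p, p) ∈ x → (u, v, w) ∈ x → (u, v, w) ≠ (p, p, p) →
    ¬u ≤ p ∧ ¬v ≤ p ∧ ¬w ≤ p)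

/-- The coordinate of the (unique, for a reduced set) diagonal triple of `x`. -/
noncomputable def piIn (x : Set (D × D × D)) : D := by
  classical exact if h : ∃ u : D, (u, u, u) ∈ x then h.choose else ⊥

/-- The partial order between reduced sets. -/
def RleIn (x y : Set (D × D × D)) : Prop :=
  ∀ t ∈ x \ y, t.1 ≤ piIn y ∨ t.2.2 ≤ piIn y

/-- A realization, inside an ambient `∨,0`-semilattice `D`, of the increasing chain
`S0 = R⁰(S0) ⊆ R¹(S0) ⊆ R²(S0) ⊆ …` of iterated free distributive extensions whose union
`D(S0)` is all of `D` : `T n` realizes `Rⁿ(S0)`, and `φ n` is the canonical bijection from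
the set of reduced subsets of `C(T n)` onto `T (n+1)`, which is an order-isomorphism
fixing `T n` (identified with the diagonal singletons). -/
structure RTower (D : Type*) [SemilatticeSup D] [OrderBot D] (S0 : Set D) where
  T : ℕ → Set D
  φ : (n : ℕ) → {x : Set (D × D × D) // IsReducedIn (T n) x} → D
  T_zero : T 0 = S0
  bot_mem : ∀ n, (⊥ : D) ∈ T n
  sup_mem : ∀ n, ∀ x ∈ T n, ∀ y ∈ T n, x ⊔ y ∈ T n
  phi_range : ∀ n, Set.range (φ n) = T (n + 1)
  phi_inj : ∀ n, Function.Injective (φ n)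
  phi_diag : ∀ (n : ℕ) (x : {x : Set (D × D × D) // IsReducedIn (T n) x}) (a : D),
    x.1 = {(a, a, a)} → φ n x = a
  phi_le : ∀ (n : ℕ) (x y : {x : Set (D × D × D) // IsReducedIn (T n) x}),
    φ n x ≤ φ n y ↔ RleIn x.1 y.1
  union_univ : (⋃ n, T n) = (Set.univ : Set D)

/-- The realization, inside `D`, of the `n`-th level `Rⁿ(B)` of the free distributive
extension of a `∨,0`-subsemilattice `B ⊆ S0`. -/
def RTower.FXn {S0 : Set D} (tw : RTower D S0) (B : Set D) : ℕ → Set D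
  | 0 => B
  | n + 1 => {d | ∃ x : {x : Set (D × D × D) // IsReducedIn (tw.T n) x},
      tw.φ n x = d ∧ ∀ t ∈ x.1, t.1 ∈ tw.FXn B n ∧ t.2.1 ∈ tw.FXn B n ∧ t.2.2 ∈ tw.FXn B n}

/-- The realization, inside `D`, of the free distributive extension `D(B)` of a
`∨,0`-subsemilattice `B ⊆ S0`. -/
def RTower.FX {S0 : Set D} (tw : RTower D S0) (B : Set D) : Set D := ⋃ n, tw.FXn B n

end Tower
section SLam

/-- A realization, inside an ambient `∨,0`-semilattice `D`, of the `∨,0`-semilattice `S(Λ)`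
presented by generators `a`, `b`, `cᵢ` (for `i ∈ Λ`) and relations `cᵢ ≤ a ⊔ b` and
`cᵢ ≤ c j` for `i ≤ j`: the listed conditions say exactly that the `∨,0`-subsemilattice
generated by `a`, `b` and the `cᵢ` is freely presented by those relations. -/
structure SLamData (D : Type*) [SemilatticeSup D] [OrderBot D]
    (Λ : Type*) [LinearOrder Λ] where
  a : D
  b : D
  c : Λ → D
  c_mono : Monotone c
  c_le_ab : ∀ i, c i ≤ a ⊔ b
  not_a_le : ∀ i, ¬ a ≤ b ⊔ c i
  not_b_le : ∀ i, ¬ b ≤ a ⊔ c i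
  not_a_le_b : ¬ a ≤ b
  not_b_le_a : ¬ b ≤ a
  not_c_le_a : ∀ i, ¬ c i ≤ a
  not_c_le_b : ∀ i, ¬ c i ≤ b
  c_le_a_sup_c : ∀ i j, c i ≤ a ⊔ c j → i ≤ j
  c_le_b_sup_c : ∀ i j, c i ≤ b ⊔ c j → i ≤ j

/-- The `∨,0`-subsemilattice `S(X)` of `S(Λ)` generated by `{0, a, b, a ⊔ b} ∪ {cᵢ : i ∈ X}`,
realized inside the ambient semilattice `D`. -/
def SLamData.SX {D : Type*} [SemilatticeSup D] [OrderBot D] {Λ : Type*} [LinearOrder Λ]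
    (sd : SLamData D Λ) (X : Set Λ) : Set D :=
  supClosure ({⊥, sd.a, sd.b, sd.a ⊔ sd.b} ∪ sd.c '' X)

end SLam
/-- The first uncountable ordinal `ω₁`, viewed as a chain: the linearly ordered set of
all ordinals `< ω₁`. -/
noncomputable abbrev Omega1 : Type 1 := {o : Ordinal // o < (Cardinal.aleph 1).ord}

theorem Omega1.exists_upper_bound {ι : Type*} [Countable ι] (f : ι → Omega1) :
    ∃ β : Omega1, ∀ i, f i ≤ β := by
  have hbdd : BddAbove (Set.range fun i => (f i).1) :=
    ⟨(Cardinal.aleph 1).ord, by rintro _ ⟨i, rfl⟩; exact (f i).2.le⟩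
  have hlt : ⨆ i, (f i).1 < (Cardinal.aleph 1).ord :=
    (Ordinal.iSup_lt_omega_one fun i => (f i).2.trans_eq (Cardinal.ord_aleph 1)).trans_eq
      (Cardinal.ord_aleph 1).symm
  exact ⟨⟨_, hlt⟩, fun i => le_ciSup hbdd i⟩

theorem Omega1.exists_gt (η : Omega1) : ∃ ξ : Omega1, η < ξ := by
  refine ⟨⟨Order.succ η.1, ?_⟩, Order.lt_succ η.1⟩
  exact (Cardinal.isSuccLimit_ord (Cardinal.aleph0_le_aleph 1)).succ_lt η.2

theorem Omega1.countable_Iio (α : Omega1) : (Set.Iio α).Countable := by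
  have h : (Set.Iio α.1).Countable := by
    rw [← Cardinal.le_aleph0_iff_set_countable, Cardinal.mk_Iio_ordinal, Cardinal.lift_le_aleph0,
      ← Cardinal.lt_aleph_one_iff]
    exact Cardinal.lt_ord.1 α.2
  exact h.preimage Subtype.val_injective

/-- Some value of a function from `ω₁` to a countable set is taken cofinally often. -/
theorem Omega1.exists_cofinal_fiber {ι : Type*} [Countable ι] (f : Omega1 → ι) :
    ∃ v, ∀ ξ, ∃ η, ξ ≤ η ∧ f η = v := by
  by_contra! h
  choose g hg using h
  obtain ⟨β, hβ⟩ := Omega1.exists_upper_bound g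
  exact hg (f β) β (hβ _) rfl

theorem Monotone.eventually_const_of_countable_range {P : Type*} [PartialOrder P]
    {x : Omega1 → P} (hx : Monotone x) (hc : (Set.range x).Countable) :
    ∃ η, ∀ ξ, η ≤ ξ → x ξ = x η := by
  have : Countable (Set.range x) := hc
  obtain ⟨v, hv⟩ := Omega1.exists_cofinal_fiber (Set.rangeFactorization x)
  obtain ⟨⟨_, η, rfl⟩, hv⟩ : ∃ w : Set.range x, ∀ ξ, ∃ η, ξ ≤ η ∧ x η = w :=
    ⟨v, fun ξ => (hv ξ).imp fun η h => ⟨h.1, congrArg Subtype.val h.2⟩⟩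
  refine ⟨η, fun ξ hξ => le_antisymm ?_ (hx hξ)⟩
  obtain ⟨ζ, hζ, e⟩ := hv ξ
  exact (hx hζ).trans e.le

theorem Set.Countable.supClosure {P : Type*} [SemilatticeSup P] {s : Set P} (hs : s.Countable) :
    (supClosure s).Countable := by
  have := hs.to_subtype
  classical
  refine (Set.countable_range fun t : {t : Finset s // t.Nonempty} =>
    t.1.sup' t.2 Subtype.val).mono ?_
  rintro _ ⟨t, ht, hts, rfl⟩
  lift t to Finset s using hts
  exact ⟨⟨t, Finset.image_nonempty.1 ht⟩, (Finset.sup'_image ht id).symm⟩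

section Dichotomy

variable {D : Type*} [SemilatticeSup D] [OrderBot D]

theorem IsReducedIn.diag_mem {A : Set D} {x : Set (D × D × D)} (hx : IsReducedIn A x) :
    (piIn x, piIn x, piIn x) ∈ x := by
  have h : ∃ u : D, (u, u, u) ∈ x := hx.2.2.1.exists
  simpa only [piIn, dif_pos h] using h.choose_spec

theorem IsReducedIn.piIn_mem {A : Set D} {x : Set (D × D × D)} (hx : IsReducedIn A x) :
    piIn x ∈ A :=
  (hx.2.1 _ hx.diag_mem).1

theorem IsReducedIn.diag_eq {A : Set D} {x : Set (D × D × D)} (hx : IsReducedIn A x) {u : D}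
    (hu : (u, u, u) ∈ x) : u = piIn x :=
  hx.2.2.1.unique hu hx.diag_mem

theorem isReducedIn_singleton {D : Type*} [SemilatticeSup D] {A : Set D} {p : D} (hp : p ∈ A) :
    IsReducedIn A {(p, p, p)} := by
  refine ⟨Set.finite_singleton _, ?_, ⟨p, by simp, by simp⟩, ?_, ?_⟩
  · rintro t rfl
    exact ⟨hp, hp, hp, le_sup_left⟩
  · intro u v w h _
    simp only [Set.mem_singleton_iff, Prod.mk.injEq] at h
    obtain ⟨rfl, rfl, rfl⟩ := h
    exact ⟨rfl, rfl⟩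
  · intro q u v w hq h hne
    exact absurd (h.trans hq.symm) hne

theorem RleIn.piIn_le {A : Set D} {x y : Set (D × D × D)} (hx : IsReducedIn A x)
    (hy : IsReducedIn A y) (h : RleIn x y) : piIn x ≤ piIn y := by
  by_cases hm : (piIn x, piIn x, piIn x) ∈ y
  · exact (hy.diag_eq hm).le
  · exact (h _ ⟨hx.diag_mem, hm⟩).elim id id

theorem RleIn.subset_of_piIn_eq {A : Set D} {x y : Set (D × D × D)} (hx : IsReducedIn A x)
    (hy : IsReducedIn A y) (h : RleIn x y) (hp : piIn x = piIn y) : x ⊆ y := by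
  rintro ⟨u, v, w⟩ ht
  by_contra hty
  have hne : (u, v, w) ≠ (piIn x, piIn x, piIn x) := by
    rintro e
    exact hty (e ▸ hp ▸ hy.diag_mem)
  obtain ⟨hu, _, hw⟩ := hx.2.2.2.2 _ u v w hx.diag_mem ht hne
  rw [hp] at hu hw
  exact (h _ ⟨ht, hty⟩).elim hu hw

namespace RTower

variable {S0 : Set D} (tw : RTower D S0)

theorem piIn_le_phi (n : ℕ) (x : {x : Set (D × D × D) // IsReducedIn (tw.T n) x}) :
    piIn x.1 ≤ tw.φ n x := by
  have hp := isReducedIn_singleton x.2.piIn_mem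
  rw [← tw.phi_diag n ⟨_, hp⟩ (piIn x.1) rfl, tw.phi_le]
  rintro t ⟨rfl, ht⟩
  exact absurd x.2.diag_mem ht

end RTower

/-- An isotone `ω₁`-sequence in `S(ω₁)` is eventually constant or dominates all `c_ξ`. -/
theorem SLamData.eventually_const_or_cofinal (sd : SLamData D Omega1) {x : Omega1 → D}
    (hx : Monotone x) (hmem : ∀ ξ, x ξ ∈ sd.SX Set.univ) :
    (∃ η, ∀ ξ, η ≤ ξ → x ξ = x η) ∨ ∀ ξ, ∃ η, sd.c ξ ≤ x η := by
  by_contra! h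
  obtain ⟨h, α, hα⟩ := h
  have hsub : sd.SX Set.univ ⊆ {y | ¬ sd.c α ≤ y → y ∈ sd.SX (Set.Iio α)} := by
    refine supClosure_min ?_ ?_
    · rintro y (hy | ⟨i, -, rfl⟩) hc
      · exact subset_supClosure (Or.inl hy)
      · refine subset_supClosure (Or.inr ⟨i, lt_of_not_ge fun hi => hc (sd.c_mono hi), rfl⟩)
    · intro y hy z hz hc
      exact supClosed_supClosure (hy fun h => hc (h.trans le_sup_left))
        (hz fun h => hc (h.trans le_sup_right))
  have hcount : (sd.SX (Set.Iio α)).Countable :=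
    ((Set.toFinite _).countable.union ((Omega1.countable_Iio α).image _)).supClosure
  obtain ⟨η, hη⟩ := hx.eventually_const_of_countable_range
    (hcount.mono (Set.range_subset_iff.2 fun ξ => hsub (hmem ξ) (hα ξ)))
  obtain ⟨ξ, hξ, hne⟩ := h η
  exact hne (hη ξ hξ)

theorem RTower.eventually_const_or_cofinal_of_level (sd : SLamData D Omega1)
    (tw : RTower D (sd.SX Set.univ)) (n : ℕ) {x : Omega1 → D}
    (hx : Monotone x) (hmem : ∀ ξ, x ξ ∈ tw.T n) :
    (∃ η, ∀ ξ, η ≤ ξ → x ξ = x η) ∨ ∀ ξ, ∃ η, sd.c ξ ≤ x η := by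
  induction n generalizing x with
  | zero => exact sd.eventually_const_or_cofinal hx (by simpa only [tw.T_zero] using hmem)
  | succ n ih =>
    simp only [← tw.phi_range, Set.mem_range] at hmem
    choose X hX using hmem
    have hle : ∀ ⦃ξ η⦄, ξ ≤ η → RleIn (X ξ).1 (X η).1 := fun ξ η h => by
      rw [← tw.phi_le, hX, hX]
      exact hx h
    rcases ih (x := fun ξ => piIn (X ξ).1) (fun ξ η h => (hle h).piIn_le (X ξ).2 (X η).2)
      (fun ξ => (X ξ).2.piIn_mem) with ⟨α, hα⟩ | hcof
    · left
      have hsub : ∀ ⦃ξ η⦄, α ≤ ξ → ξ ≤ η → (X ξ).1 ⊆ (X η).1 := fun ξ η h h' =>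
        (hle h').subset_of_piIn_eq (X ξ).2 (X η).2 ((hα ξ h).trans (hα η (h.trans h')).symm)
      have hcard : Monotone fun ξ => (X (max α ξ)).1.ncard := fun ξ η h =>
        Set.ncard_le_ncard (hsub (le_max_left _ _) (max_le_max le_rfl h)) (X _).2.1
      obtain ⟨β, hβ⟩ := hcard.eventually_const_of_countable_range (Set.to_countable _)
      refine ⟨max α β, fun ξ hξ => ?_⟩
      have hcardξ := hβ ξ ((le_max_right _ _).trans hξ)
      simp only [max_eq_right ((le_max_left _ _).trans hξ)] at hcardξ
      have heq := Set.eq_of_subset_of_ncard_le (hsub (le_max_left _ _) hξ) hcardξ.le (X ξ).2.1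
      rw [← hX, ← hX, Subtype.ext heq]
    · right
      intro ξ
      obtain ⟨η, hη⟩ := hcof ξ
      exact ⟨η, hη.trans (hX η ▸ tw.piIn_le_phi n (X η))⟩

/-- An isotone `ω₁`-sequence in `F(ω₁)` is eventually constant or dominates all `c_ξ`. -/
theorem RTower.eventually_const_or_cofinal (sd : SLamData D Omega1)
    (tw : RTower D (sd.SX Set.univ)) {x : Omega1 → D} (hx : Monotone x) :
    (∃ η, ∀ ξ, η ≤ ξ → x ξ = x η) ∨ ∀ ξ, ∃ η, sd.c ξ ≤ x η := by
  have hlevel : ∀ ξ, ∃ n, x ξ ∈ tw.T n := fun ξ =>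
    Set.mem_iUnion.1 (tw.union_univ ▸ Set.mem_univ (x ξ))
  choose l hl using hlevel
  obtain ⟨n, hn⟩ := Omega1.exists_cofinal_fiber l
  let f : Omega1 → Omega1 := fun ξ => wellFounded_lt.min {η | ξ ≤ η ∧ l η = n} (hn ξ)
  have hf : ∀ ξ, ξ ≤ f ξ ∧ l (f ξ) = n := fun ξ => wellFounded_lt.min_mem _ (hn ξ)
  have hfmono : Monotone f := fun ξ η h =>
    wellFounded_lt.min_le
      (show f η ∈ {ζ | ξ ≤ ζ ∧ l ζ = n} from ⟨h.trans (hf η).1, (hf η).2⟩)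
  rcases tw.eventually_const_or_cofinal_of_level sd n (hx.comp hfmono)
    (fun ξ => (hf ξ).2 ▸ hl (f ξ)) with ⟨η, hη⟩ | hcof
  · refine Or.inl ⟨f η, fun ξ hξ => le_antisymm ?_ (hx hξ)⟩
    exact (hx (hf ξ).1).trans (hη ξ ((hf η).1.trans hξ)).le
  · exact Or.inr fun ξ => (hcof ξ).imp' f fun η h => h

end Dichotomy

/-- the monotone refinement failure in `F(ω₁)`: there is no finite chain of
isotone `ω₁`-sequences interpolating between `0` and `c_ξ` with successive steps below
`a ∨ (previous)` or `b ∨ (previous)`. -/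
theorem no_finite_interpolating_sequences (D : Type*) [SemilatticeSup D] [OrderBot D]
    (sd : SLamData D Omega1) (tw : RTower D (sd.SX Set.univ)) :
    ¬∃ (n : ℕ) (x : ℕ → Omega1 → D), 0 < n ∧
      (∀ i ≤ n, Monotone (x i)) ∧
      (∃ η₀ : Omega1, ∀ ξ : Omega1, η₀ ≤ ξ → x 0 ξ = ⊥ ∧ x n ξ = sd.c ξ) ∧
      (∃ η₁ : Omega1, ∀ ξ : Omega1, η₁ ≤ ξ → ∀ i ≤ n, x i ξ ≤ sd.c ξ) ∧
      (∀ i < n, ∀ ξ : Omega1, x (i + 1) ξ ≤ sd.a ⊔ x i ξ ∨ x (i + 1) ξ ≤ sd.b ⊔ x i ξ) := by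
  rintro ⟨n, x, -, hmono, ⟨η₀, h₀⟩, ⟨η₁, h₁⟩, hstep⟩
  have key : ∀ k ≤ n, ∀ ξ, ∃ η, sd.c ξ ≤ x (n - k) η := by
    intro k
    induction k with
    | zero =>
      intro _ ξ
      exact ⟨max η₀ ξ, by
        simpa [(h₀ _ (le_max_left η₀ ξ)).2] using sd.c_mono (le_max_right η₀ ξ)⟩
    | succ k ih =>
      intro hk
      obtain ⟨i, hi⟩ : ∃ i, i = n - (k + 1) := ⟨_, rfl⟩
      have hi' : n - k = i + 1 := by omega
      rw [← hi]
      have hcof := ih (by omega)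
      rw [hi'] at hcof
      refine (tw.eventually_const_or_cofinal sd (hmono i (by omega))).resolve_left ?_
      rintro ⟨η, hη⟩
      obtain ⟨ξ, hξ⟩ := Omega1.exists_gt (max η η₁)
      obtain ⟨ζ, hζ⟩ := hcof ξ
      have hd : x i (max (max η η₁) ζ) ≤ sd.c (max η η₁) := by
        rw [hη _ ((le_max_left _ _).trans (le_max_left _ _)), ← hη _ (le_max_left η η₁)]
        exact h₁ _ (le_max_right _ _) i (by omega)
      have hc := hζ.trans (hmono (i + 1) (by omega) (le_max_right (max η η₁) ζ))
      rcases hstep i (by omega) (max (max η η₁) ζ) with h | h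
      · exact hξ.not_ge (sd.c_le_a_sup_c _ _ ((hc.trans h).trans (sup_le_sup_left hd _)))
      · exact hξ.not_ge (sd.c_le_b_sup_c _ _ ((hc.trans h).trans (sup_le_sup_left hd _)))
  obtain ⟨η, hη⟩ := key n le_rfl η₀
  rw [Nat.sub_self] at hη
  have hbot := hη.trans (hmono 0 n.zero_le (le_max_right η₀ η))
  rw [(h₀ _ (le_max_left η₀ η)).1] at hbot
  exact sd.not_c_le_a η₀ (hbot.trans bot_le)
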